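/- arXiv:2002.09855 — 6 statements merged into one kernel-verified Lean document; each statement's English description precedes it below -/
import Mathlib

section
/- Let p be a prime and let U be the real 4×4 matrix U = (1/p)·[[1, √(p−1), √(p−1), p−1], [√(p−1), −1, p−1, −√(p−1)], [√(p−1), p−1, −1, −√(p−1)], [p−1, −√(p−1), −√(p−1), 1]]. Then U is symmetric (Uᵗ = U) and U² = I; in particular U is unitary and U⁴ = I. -/
open Matrix

/-- The unitary matrix attached to the supercharacter table of `ℤ_p²` for the diagonal
subgroup of `GL₂(ℤ/pℤ)`: it is symmetric, squares to the identity, is unitary, and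
its fourth power is the identity. -/
theorem stmt3 (p : ℕ) [Fact p.Prime]
    (U : Matrix (Fin 4) (Fin 4) ℝ)
    (hU : U = (1 / (p : ℝ)) •
      !![1, Real.sqrt ((p : ℝ) - 1), Real.sqrt ((p : ℝ) - 1), (p : ℝ) - 1;
         Real.sqrt ((p : ℝ) - 1), -1, (p : ℝ) - 1, -Real.sqrt ((p : ℝ) - 1);
         Real.sqrt ((p : ℝ) - 1), (p : ℝ) - 1, -1, -Real.sqrt ((p : ℝ) - 1);
         (p : ℝ) - 1, -Real.sqrt ((p : ℝ) - 1), -Real.sqrt ((p : ℝ) - 1), 1]) :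
    Uᵀ = U ∧ U * U = 1 ∧ U ∈ Matrix.unitaryGroup (Fin 4) ℝ ∧ U ^ 4 = 1 := by
  have hp : (1 : ℝ) ≤ p := by exact_mod_cast (Fact.out : p.Prime).one_le
  have hp0 : (p : ℝ) ≠ 0 := by positivity
  have hs : Real.sqrt ((p : ℝ) - 1) ^ 2 = p - 1 := Real.sq_sqrt (by linarith)
  have hsymm : Uᵀ = U := by
    subst hU
    ext i j
    fin_cases i <;> fin_cases j <;> simp
  have hsq : U * U = 1 := by
    subst hU
    generalize Real.sqrt ((p : ℝ) - 1) = s at hs ⊢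
    rw [Matrix.smul_mul, Matrix.mul_smul, smul_smul]
    ext i j
    fin_cases i <;> fin_cases j <;>
      simp <;> field_simp <;> grind
  refine ⟨hsymm, hsq, ?_, ?_⟩
  · rw [Matrix.mem_unitaryGroup_iff, Matrix.star_eq_conjTranspose,
      Matrix.conjTranspose_eq_transpose_of_trivial, hsymm, hsq]
  · rw [pow_mul U 2 2, pow_two U, hsq, one_pow]
end

section
/- Let p be a prime and Γ = {[[a,b,c],[0,d,b],[0,0,a]] : a,d ∈ (ℤ/pℤ)ˣ, b,c ∈ ℤ/pℤ} ≤ GL₃(ℤ/pℤ) act on row vectors of (ℤ/pℤ)³ by y ↦ yA. Then the orbits of Γ on (ℤ/pℤ)³ are exactly Y₁ = {(0,0,0)}, Y₂ = {(0,0,a) : a ≠ 0}, Y₃ = {(0,d,b) : d ≠ 0, b ∈ ℤ/pℤ}, Y₄ = {(a,b,c) : a ≠ 0, b,c ∈ ℤ/pℤ}, of sizes 1, p−1, p(p−1), p²(p−1) respectively. -/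
/-- The set of matrices `[[a,b,c],[0,d,b],[0,0,a]]` with `a`, `d` units. -/
def triangularMatrices (K : Type*) [CommRing K] : Set (Matrix (Fin 3) (Fin 3) K) :=
  {A | ∃ (a d : Kˣ) (b c : K), A = !![(a : K), b, c; 0, (d : K), b; 0, 0, (a : K)]}

/-- The orbit of a row vector under `triangularMatrices`. -/
def triangularOrbit {K : Type*} [CommRing K] (y : Fin 3 → K) : Set (Fin 3 → K) :=
  {z | ∃ A ∈ triangularMatrices K, z = Matrix.vecMul y A}

theorem mem_triangularOrbit_iff {K : Type*} [CommRing K] {y z : Fin 3 → K} :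
    z ∈ triangularOrbit y ↔ ∃ (a d : Kˣ) (b c : K), z 0 = y 0 * a ∧
      z 1 = y 0 * b + y 1 * d ∧ z 2 = y 0 * c + y 1 * b + y 2 * a := by
  constructor
  · rintro ⟨_, ⟨a, d, b, c, rfl⟩, rfl⟩
    exact ⟨a, d, b, c, by simp [Matrix.vecMul, dotProduct, Fin.sum_univ_three]⟩
  · rintro ⟨a, d, b, c, h0, h1, h2⟩
    refine ⟨_, ⟨a, d, b, c, rfl⟩, ?_⟩
    ext i
    fin_cases i <;> simp [Matrix.vecMul, dotProduct, Fin.sum_univ_three, h0, h1, h2]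

section Field

variable {K : Type*} [Field K] {y : Fin 3 → K}

theorem triangularOrbit_of_ne_zero (h0 : y 0 ≠ 0) : triangularOrbit y = {z | z 0 ≠ 0} := by
  ext z
  rw [mem_triangularOrbit_iff, Set.mem_ofPred_eq]
  constructor
  · rintro ⟨a, d, b, c, hz, -⟩
    simp [hz, h0]
  · intro hz
    refine ⟨Units.mk0 (z 0 / y 0) (div_ne_zero hz h0), 1, (z 1 - y 1) / y 0,
      (z 2 - y 1 * ((z 1 - y 1) / y 0) - y 2 * (z 0 / y 0)) / y 0, ?_, ?_, ?_⟩ <;>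
    simp only [Units.val_mk0, Units.val_one] <;> field_simp <;> ring

theorem triangularOrbit_of_fst_eq_zero (h0 : y 0 = 0) (h1 : y 1 ≠ 0) :
    triangularOrbit y = {z | z 0 = 0 ∧ z 1 ≠ 0} := by
  ext z
  rw [mem_triangularOrbit_iff, Set.mem_ofPred_eq]
  constructor
  · rintro ⟨a, d, b, c, hz0, hz1, -⟩
    simp [hz0, hz1, h0, h1]
  · rintro ⟨hz0, hz1⟩
    refine ⟨1, Units.mk0 (z 1 / y 1) (div_ne_zero hz1 h1), (z 2 - y 2) / y 1, 0, ?_, ?_, ?_⟩ <;>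
    simp only [Units.val_mk0, Units.val_one, h0, hz0] <;> field_simp <;> ring

theorem triangularOrbit_of_fst_snd_eq_zero (h0 : y 0 = 0) (h1 : y 1 = 0) (h2 : y 2 ≠ 0) :
    triangularOrbit y = {z | z 0 = 0 ∧ z 1 = 0 ∧ z 2 ≠ 0} := by
  ext z
  rw [mem_triangularOrbit_iff, Set.mem_ofPred_eq]
  constructor
  · rintro ⟨a, d, b, c, hz0, hz1, hz2⟩
    simp [hz0, hz1, hz2, h0, h1, h2]
  · rintro ⟨hz0, hz1, hz2⟩
    refine ⟨Units.mk0 (z 2 / y 2) (div_ne_zero hz2 h2), 1, 0, 0, ?_, ?_, ?_⟩ <;>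
    simp [h0, h1, h2, hz0, hz1, mul_div_cancel₀]

theorem triangularOrbit_of_eq_zero (h0 : y 0 = 0) (h1 : y 1 = 0) (h2 : y 2 = 0) :
    triangularOrbit y = {z | z 0 = 0 ∧ z 1 = 0 ∧ z 2 = 0} := by
  ext z
  simp [mem_triangularOrbit_iff, h0, h1, h2]

theorem setOf_triangularOrbit :
    {S | ∃ y : Fin 3 → K, S = triangularOrbit y} =
      {{y | y 0 = 0 ∧ y 1 = 0 ∧ y 2 = 0},
       {y | y 0 = 0 ∧ y 1 = 0 ∧ y 2 ≠ 0},
       {y | y 0 = 0 ∧ y 1 ≠ 0},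
       {y | y 0 ≠ 0}} := by
  ext S
  simp only [Set.mem_ofPred_eq, Set.mem_insert_iff, Set.mem_singleton_iff]
  constructor
  · rintro ⟨y, rfl⟩
    by_cases h0 : y 0 = 0
    · by_cases h1 : y 1 = 0
      · by_cases h2 : y 2 = 0
        · exact .inl (triangularOrbit_of_eq_zero h0 h1 h2)
        · exact .inr (.inl (triangularOrbit_of_fst_snd_eq_zero h0 h1 h2))
      · exact .inr (.inr (.inl (triangularOrbit_of_fst_eq_zero h0 h1)))
    · exact .inr (.inr (.inr (triangularOrbit_of_ne_zero h0)))
  · rintro (rfl | rfl | rfl | rfl)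
    · exact ⟨0, (triangularOrbit_of_eq_zero rfl rfl rfl).symm⟩
    · exact ⟨![0, 0, 1], (triangularOrbit_of_fst_snd_eq_zero rfl rfl one_ne_zero).symm⟩
    · exact ⟨![0, 1, 0], (triangularOrbit_of_fst_eq_zero rfl one_ne_zero).symm⟩
    · exact ⟨![1, 0, 0], (triangularOrbit_of_ne_zero one_ne_zero).symm⟩

end Field

theorem ncard_setOf_mem_fin_three {α : Type*} [DecidableEq α] (s t u : Finset α) :
    {y : Fin 3 → α | y 0 ∈ s ∧ y 1 ∈ t ∧ y 2 ∈ u}.ncard = s.card * t.card * u.card := by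
  have h : {y : Fin 3 → α | y 0 ∈ s ∧ y 1 ∈ t ∧ y 2 ∈ u} =
      (Fintype.piFinset ![s, t, u] : Finset (Fin 3 → α)) := by
    ext y
    simp [Fin.forall_fin_succ]
  rw [h, Set.ncard_coe_finset, Fintype.card_piFinset]
  simp [Fin.prod_univ_three]

/-- The orbits of `Γ = {[[a,b,c],[0,d,b],[0,0,a]] : a,d units}` acting on row vectors
of `(ℤ/pℤ)³` by `y ↦ yA` are exactly `{(0,0,0)}`, `{(0,0,a) : a ≠ 0}`,
`{(0,d,b) : d ≠ 0}`, `{(a,b,c) : a ≠ 0}`, of sizes `1`, `p-1`, `p(p-1)`, `p²(p-1)`. -/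
theorem stmt9 (p : ℕ) [Fact p.Prime]
    (Γ : Set (Matrix (Fin 3) (Fin 3) (ZMod p)))
    (hΓ : Γ = {A | ∃ (a d : (ZMod p)ˣ) (b c : ZMod p),
      A = !![(a : ZMod p), b, c; 0, (d : ZMod p), b; 0, 0, (a : ZMod p)]})
    (orb : (Fin 3 → ZMod p) → Set (Fin 3 → ZMod p))
    (horb : ∀ y, orb y = {z | ∃ A ∈ Γ, z = Matrix.vecMul y A}) :
    {S | ∃ y, S = orb y} =
      {{y | y 0 = 0 ∧ y 1 = 0 ∧ y 2 = 0},
       {y | y 0 = 0 ∧ y 1 = 0 ∧ y 2 ≠ 0},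
       {y | y 0 = 0 ∧ y 1 ≠ 0},
       {y | y 0 ≠ 0}} ∧
    ({y : Fin 3 → ZMod p | y 0 = 0 ∧ y 1 = 0 ∧ y 2 = 0}).ncard = 1 ∧
    ({y : Fin 3 → ZMod p | y 0 = 0 ∧ y 1 = 0 ∧ y 2 ≠ 0}).ncard = p - 1 ∧
    ({y : Fin 3 → ZMod p | y 0 = 0 ∧ y 1 ≠ 0}).ncard = p * (p - 1) ∧
    ({y : Fin 3 → ZMod p | y 0 ≠ 0}).ncard = p ^ 2 * (p - 1) := by
  have horb' : orb = triangularOrbit := by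
    subst hΓ
    exact funext horb
  refine ⟨horb' ▸ setOf_triangularOrbit, ?_, ?_, ?_, ?_⟩
  · simpa using ncard_setOf_mem_fin_three {(0 : ZMod p)} {0} {0}
  · simpa [Finset.card_compl] using ncard_setOf_mem_fin_three {(0 : ZMod p)} {0} {0}ᶜ
  · simpa [Finset.card_compl, mul_comm] using
      ncard_setOf_mem_fin_three {(0 : ZMod p)} {0}ᶜ Finset.univ
  · simpa [Finset.card_compl, mul_comm, mul_assoc, mul_left_comm, sq] using
      ncard_setOf_mem_fin_three {(0 : ZMod p)}ᶜ Finset.univ Finset.univ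
end

section
/- Let p be a prime and Γ = {[[a,b,c],[0,d,b],[0,0,a]] : a,d ∈ (ℤ/pℤ)ˣ, b,c ∈ ℤ/pℤ} ≤ GL₃(ℤ/pℤ) act on row vectors of (ℤ/pℤ)³ by x ↦ x·A^{−t} (right multiplication by the inverse transpose). Then the orbits of this action are exactly X₁ = {(0,0,0)}, X₂ = {(a,0,0) : a ≠ 0}, X₃ = {(a,b,0) : b ≠ 0, a ∈ ℤ/pℤ}, X₄ = {(a,b,c) : c ≠ 0, a,b ∈ ℤ/pℤ}, of sizes 1, p−1, p(p−1), p²(p−1) respectively. -/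
open Matrix

theorem ncard_fin_three_box {α : Type*} [DecidableEq α] (s t u : Finset α) :
    {x : Fin 3 → α | x 0 ∈ s ∧ x 1 ∈ t ∧ x 2 ∈ u}.ncard = s.card * t.card * u.card := by
  have h : {x : Fin 3 → α | x 0 ∈ s ∧ x 1 ∈ t ∧ x 2 ∈ u} =
      (Fintype.piFinset ![s, t, u] : Finset (Fin 3 → α)) := by
    ext x
    simp [Fin.forall_fin_succ]
  rw [h, Set.ncard_coe_finset, Fintype.card_piFinset, Fin.prod_univ_three]
  rfl

theorem eq_vecMul_transpose_inv_iff {n R : Type*} [Fintype n] [DecidableEq n] [CommRing R]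
    {A : Matrix n n R} (hA : IsUnit A.det) (x z : n → R) :
    z = x ᵥ* (Aᵀ)⁻¹ ↔ x = A *ᵥ z := by
  have hA' : IsUnit Aᵀ.det := by rwa [det_transpose]
  rw [← vecMul_transpose]
  constructor
  · rintro rfl
    rw [vecMul_vecMul, nonsing_inv_mul _ hA', vecMul_one]
  · rintro rfl
    rw [vecMul_vecMul, mul_nonsing_inv _ hA', vecMul_one]

/-- Two vectors are related by a matrix `[[a,b,c],[0,d,b],[0,0,a]]` with `a`, `d` units exactly
when their last nonzero coordinates have the same index. -/
theorem exists_units_smul_iff {F : Type*} [Field F] (x z : Fin 3 → F) :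
    (∃ (a d : Fˣ) (b c : F), x 0 = a * z 0 + b * z 1 + c * z 2 ∧
      x 1 = d * z 1 + b * z 2 ∧ x 2 = a * z 2) ↔
    (x 2 = 0 ↔ z 2 = 0) ∧ (x 2 = 0 → (x 1 = 0 ↔ z 1 = 0)) ∧
      (x 2 = 0 → x 1 = 0 → (x 0 = 0 ↔ z 0 = 0)) := by
  constructor
  · rintro ⟨a, d, b, c, h0, h1, h2⟩
    have e2 : x 2 = 0 ↔ z 2 = 0 := by simp [h2]
    have e1 : x 2 = 0 → (x 1 = 0 ↔ z 1 = 0) := fun h => by simp [h1, e2.1 h]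
    exact ⟨e2, e1, fun h h' => by simp [h0, e2.1 h, (e1 h).1 h']⟩
  · rintro ⟨e2, e1, e0⟩
    by_cases h2 : x 2 = 0
    · have z2 := e2.1 h2
      by_cases h1 : x 1 = 0
      · have z1 := (e1 h2).1 h1
        by_cases h0 : x 0 = 0
        · exact ⟨1, 1, 0, 0, by simp [h0, (e0 h2 h1).1 h0], by simp [h1, z1], by simp [h2, z2]⟩
        · have z0 : z 0 ≠ 0 := mt (e0 h2 h1).2 h0
          exact ⟨Units.mk0 (x 0 / z 0) (div_ne_zero h0 z0), 1, 0, 0, by simp [z0],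
            by simp [h1, z1], by simp [h2, z2]⟩
      · have z1 : z 1 ≠ 0 := mt (e1 h2).2 h1
        exact ⟨1, Units.mk0 (x 1 / z 1) (div_ne_zero h1 z1), (x 0 - z 0) / z 1, 0, by simp [z1],
          by simp [z1, z2], by simp [h2, z2]⟩
    · have z2 : z 2 ≠ 0 := mt e2.2 h2
      exact ⟨Units.mk0 (x 2 / z 2) (div_ne_zero h2 z2), 1, (x 1 - z 1) / z 2,
        (x 0 - x 2 / z 2 * z 0 - (x 1 - z 1) / z 2 * z 1) / z 2, by simp [z2], by simp [z2],
        by simp [z2]⟩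

/-- The orbits of `Γ = {[[a,b,c],[0,d,b],[0,0,a]] : a,d units}` acting on row vectors
of `(ℤ/pℤ)³` by `x ↦ x·A⁻ᵗ` are exactly `{(0,0,0)}`, `{(a,0,0) : a ≠ 0}`,
`{(a,b,0) : b ≠ 0}`, `{(a,b,c) : c ≠ 0}`, of sizes `1`, `p-1`, `p(p-1)`, `p²(p-1)`. -/
theorem stmt10 (p : ℕ) [Fact p.Prime]
    (Γ : Set (Matrix (Fin 3) (Fin 3) (ZMod p)))
    (hΓ : Γ = {A | ∃ (a d : (ZMod p)ˣ) (b c : ZMod p),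
      A = !![(a : ZMod p), b, c; 0, (d : ZMod p), b; 0, 0, (a : ZMod p)]})
    (orb : (Fin 3 → ZMod p) → Set (Fin 3 → ZMod p))
    (horb : ∀ x, orb x = {z | ∃ A ∈ Γ, z = Matrix.vecMul x (Aᵀ)⁻¹}) :
    {S | ∃ x, S = orb x} =
      {{x | x 0 = 0 ∧ x 1 = 0 ∧ x 2 = 0},
       {x | x 0 ≠ 0 ∧ x 1 = 0 ∧ x 2 = 0},
       {x | x 1 ≠ 0 ∧ x 2 = 0},
       {x | x 2 ≠ 0}} ∧
    ({x : Fin 3 → ZMod p | x 0 = 0 ∧ x 1 = 0 ∧ x 2 = 0}).ncard = 1 ∧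
    ({x : Fin 3 → ZMod p | x 0 ≠ 0 ∧ x 1 = 0 ∧ x 2 = 0}).ncard = p - 1 ∧
    ({x : Fin 3 → ZMod p | x 1 ≠ 0 ∧ x 2 = 0}).ncard = p * (p - 1) ∧
    ({x : Fin 3 → ZMod p | x 2 ≠ 0}).ncard = p ^ 2 * (p - 1) := by
  have mem_orb (x z : Fin 3 → ZMod p) : z ∈ orb x ↔
      (x 2 = 0 ↔ z 2 = 0) ∧ (x 2 = 0 → (x 1 = 0 ↔ z 1 = 0)) ∧
        (x 2 = 0 → x 1 = 0 → (x 0 = 0 ↔ z 0 = 0)) := by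
    rw [← exists_units_smul_iff, horb, hΓ]
    have key (a d : (ZMod p)ˣ) (b c : ZMod p) :
        z = x ᵥ* (!![(a : ZMod p), b, c; 0, (d : ZMod p), b; 0, 0, (a : ZMod p)]ᵀ)⁻¹ ↔
        x 0 = a * z 0 + b * z 1 + c * z 2 ∧ x 1 = d * z 1 + b * z 2 ∧ x 2 = a * z 2 := by
      rw [eq_vecMul_transpose_inv_iff (by simp [det_fin_three]), funext_iff]
      simp [Fin.forall_fin_succ, mulVec, dotProduct, Fin.sum_univ_three]
    constructor
    · rintro ⟨_, ⟨a, d, b, c, rfl⟩, h⟩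
      exact ⟨a, d, b, c, (key a d b c).1 h⟩
    · rintro ⟨a, d, b, c, h⟩
      exact ⟨_, ⟨a, d, b, c, rfl⟩, (key a d b c).2 h⟩
  have card_ne : (Finset.univ.erase (0 : ZMod p)).card = p - 1 := by
    rw [Finset.card_erase_of_mem (Finset.mem_univ _), Finset.card_univ, ZMod.card]
  refine ⟨?_, ?_, ?_, ?_, ?_⟩
  · ext S
    simp only [Set.mem_ofPred_eq, Set.mem_insert_iff, Set.mem_singleton_iff]
    constructor
    · rintro ⟨x, rfl⟩
      by_cases h2 : x 2 = 0
      · by_cases h1 : x 1 = 0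
        · by_cases h0 : x 0 = 0
          · left
            ext z
            simp only [mem_orb, Set.mem_ofPred_eq]
            tauto
          · right; left
            ext z
            simp only [mem_orb, Set.mem_ofPred_eq]
            tauto
        · right; right; left
          ext z
          simp only [mem_orb, Set.mem_ofPred_eq]
          tauto
      · right; right; right
        ext z
        simp only [mem_orb, Set.mem_ofPred_eq]
        tauto
    · rintro (rfl | rfl | rfl | rfl)
      · refine ⟨![0, 0, 0], ?_⟩
        ext z
        simp [mem_orb]
        tauto
      · refine ⟨![1, 0, 0], ?_⟩
        ext z
        simp [mem_orb]
        tauto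
      · refine ⟨![0, 1, 0], ?_⟩
        ext z
        simp [mem_orb]
        tauto
      · refine ⟨![0, 0, 1], ?_⟩
        ext z
        simp [mem_orb]
  · simpa using ncard_fin_three_box {(0 : ZMod p)} {0} {0}
  · simpa [card_ne] using ncard_fin_three_box (Finset.univ.erase (0 : ZMod p)) {0} {0}
  · simpa [card_ne] using ncard_fin_three_box Finset.univ (Finset.univ.erase (0 : ZMod p)) {0}
  · simpa [card_ne, sq] using
      ncard_fin_three_box Finset.univ Finset.univ (Finset.univ.erase (0 : ZMod p))
end

section
/- Let p be a prime and let U be the real 4×4 matrix U = (1/(p√p))·[[1, √(p−1), √(p(p−1)), p√(p−1)], [√(p−1), p−1, (p−1)√p, −p], [√(p(p−1)), (p−1)√p, −p, 0], [p√(p−1), −p, 0, 0]]. Then U is symmetric (Uᵗ = U) and U² = I; in particular U is unitary and U⁴ = I. -/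
open Matrix

/-- With `r = √p` and `s = √(p - 1)`, the unnormalised matrix squares to `p³`. -/
lemma supercharacterMatrix_mul_self {p r s : ℝ} (hr : r ^ 2 = p) (hs : s ^ 2 = p - 1) :
    !![1, s, r * s, p * s; s, p - 1, (p - 1) * r, -p;
        r * s, (p - 1) * r, -p, 0; p * s, -p, 0, 0] *
      !![1, s, r * s, p * s; s, p - 1, (p - 1) * r, -p;
        r * s, (p - 1) * r, -p, 0; p * s, -p, 0, 0] =
      (p ^ 3) • (1 : Matrix (Fin 4) (Fin 4) ℝ) := by
  ext i j
  fin_cases i <;> fin_cases j <;>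
    simp [Matrix.mul_apply, Fin.sum_univ_four] <;> grind

/-- The unitary matrix attached to the supercharacter table of `ℤ_p³` for the
`J`-symmetric group `Γ = {[[a,b,c],[0,d,b],[0,0,a]] : a,d units}`: it is symmetric,
squares to the identity, is unitary, and its fourth power is the identity. -/
theorem stmt13 (p : ℕ) [Fact p.Prime]
    (U : Matrix (Fin 4) (Fin 4) ℝ)
    (hU : U = (1 / ((p : ℝ) * Real.sqrt p)) •
      !![1, Real.sqrt ((p : ℝ) - 1), Real.sqrt ((p : ℝ) * ((p : ℝ) - 1)),
           (p : ℝ) * Real.sqrt ((p : ℝ) - 1);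
         Real.sqrt ((p : ℝ) - 1), (p : ℝ) - 1, ((p : ℝ) - 1) * Real.sqrt p, -(p : ℝ);
         Real.sqrt ((p : ℝ) * ((p : ℝ) - 1)), ((p : ℝ) - 1) * Real.sqrt p, -(p : ℝ), 0;
         (p : ℝ) * Real.sqrt ((p : ℝ) - 1), -(p : ℝ), 0, 0]) :
    Uᵀ = U ∧ U * U = 1 ∧ U ∈ Matrix.unitaryGroup (Fin 4) ℝ ∧ U ^ 4 = 1 := by
  have hp : (1 : ℝ) < p := by exact_mod_cast (Fact.out : p.Prime).one_lt
  have hp0 : (0 : ℝ) ≤ p := by linarith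
  have hr := Real.sq_sqrt hp0
  have hs := Real.sq_sqrt (sub_nonneg.2 hp.le)
  rw [Real.sqrt_mul hp0] at hU
  have hT : Uᵀ = U := by
    rw [hU]
    ext i j
    fin_cases i <;> fin_cases j <;> simp
  have hsq : U * U = 1 := by
    have hc : 1 / ((p : ℝ) * √p) * (1 / (p * √p)) * (p : ℝ) ^ 3 = 1 := by
      have : √(p : ℝ) ≠ 0 := (Real.sqrt_pos.2 (by linarith)).ne'
      field_simp
      rw [hr]
    rw [hU, smul_mul_smul_comm, supercharacterMatrix_mul_self hr hs, smul_smul, hc, one_smul]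
  refine ⟨hT, hsq, ?_, ?_⟩
  · rw [Matrix.mem_unitaryGroup_iff, Matrix.star_eq_conjTranspose,
      Matrix.conjTranspose_eq_transpose_of_trivial, hT, hsq]
  · rw [pow_mul U 2 2, pow_two U, hsq, one_pow]
end

section
/- Let p be a prime, d ≥ 1, and let Γ ≤ GL_d(ℤ/pℤ) be the group of upper triangular unipotent Toeplitz matrices, acting on row vectors of (ℤ/pℤ)^d by y ↦ yA. Then for each 1 ≤ i ≤ d and α ∈ (ℤ/pℤ)ˣ, the orbit of the vector with α in position i and zeros elsewhere is exactly {z ∈ (ℤ/pℤ)^d : z_j = 0 for all j < i, and z_i = α}, which has size p^{d−i}. -/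
open Matrix

/-- The upper shift matrix `N` with `N_{i,i+1} = 1` and all other entries `0`. -/
def shiftN (p d : ℕ) : Matrix (Fin d) (Fin d) (ZMod p) :=
  Matrix.of fun i j => if (i : ℕ) + 1 = (j : ℕ) then 1 else 0

theorem shiftN_pow_apply (p d k : ℕ) (r c : Fin d) :
    (shiftN p d ^ k) r c = if (r : ℕ) + k = c then 1 else 0 := by
  induction k generalizing r with
  | zero => simp [Matrix.one_apply, Fin.ext_iff]
  | succ k ih =>
    rw [pow_succ', Matrix.mul_apply]
    simp only [ih]
    simp only [shiftN, Matrix.of_apply, ite_mul, one_mul, zero_mul]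
    by_cases hr : (r : ℕ) + 1 < d
    · rw [Finset.sum_eq_single ⟨r + 1, hr⟩]
      · simp [add_assoc, add_comm 1 k]
      · intro b _ hb
        rw [if_neg fun h => hb (Fin.ext h.symm)]
      · simp
    · rw [if_neg (by omega)]
      exact Finset.sum_eq_zero fun b _ => if_neg (by omega)

theorem one_add_sum_smul_shiftN_pow_apply (p d : ℕ) (a : ℕ → ZMod p) (r c : Fin d) :
    (1 + ∑ k ∈ Finset.Ico 1 d, a (k + 1) • shiftN p d ^ k) r c =
      if r = c then 1 else if r < c then a (c - r + 1) else 0 := by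
  simp only [Matrix.add_apply, Matrix.sum_apply, Matrix.smul_apply, shiftN_pow_apply,
    Matrix.one_apply, smul_eq_mul, mul_ite, mul_one, mul_zero]
  rcases lt_trichotomy r c with h | rfl | h
  · rw [if_neg h.ne, if_neg h.ne, if_pos h, zero_add, Finset.sum_eq_single ((c : ℕ) - r)]
    · rw [if_pos (by omega)]
    · intro b _ hb
      exact if_neg (by omega)
    · intro hc
      exact absurd (Finset.mem_Ico.2 (by omega)) hc
  · rw [if_pos rfl, if_pos rfl, add_eq_left]
    exact Finset.sum_eq_zero fun k hk => if_neg (by have := Finset.mem_Ico.1 hk; omega)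
  · rw [if_neg h.ne', if_neg h.ne', if_neg h.not_gt, zero_add]
    exact Finset.sum_eq_zero fun k _ => if_neg (by omega)

theorem ncard_setOf_forall_lt_eq_zero_and_eq {R : Type*} [Zero R] [Fintype R] {d : ℕ}
    (i : Fin d) (x : R) :
    {z : Fin d → R | (∀ j, j < i → z j = 0) ∧ z i = x}.ncard =
      Fintype.card R ^ (d - 1 - (i : ℕ)) := by
  classical
  have h : {z : Fin d → R | (∀ j, j < i → z j = 0) ∧ z i = x} =
      Fintype.piFinset fun j =>
        if i < j then Finset.univ else if j = i then {x} else {(0 : R)} := by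
    ext z
    simp only [Set.mem_ofPred_eq, Finset.mem_coe, Fintype.mem_piFinset]
    constructor
    · rintro ⟨h0, hx⟩ j
      rcases lt_trichotomy i j with h | rfl | h
      · simp [h]
      · simp [hx]
      · simp [h.not_gt, h.ne, h0 j h]
    · intro h
      refine ⟨fun j hj => ?_, by simpa using h i⟩
      simpa [hj.not_gt, hj.ne] using h j
  rw [h, Set.ncard_coe_finset, Fintype.card_piFinset, ← Fin.card_Ioi i, ← Finset.prod_const,
    ← Finset.filter_lt_eq_Ioi, Finset.prod_filter]
  refine Finset.prod_congr rfl fun j _ => ?_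
  split_ifs <;> simp

/-- For the group `Γ` of upper triangular unipotent Toeplitz matrices acting on row
vectors of `(ℤ/pℤ)^d` by `y ↦ yA`, the orbit of the vector with a unit `α` in
position `i` and zeros elsewhere is `{z : z_j = 0 for j < i, z_i = α}`, of size
`p^{d-1-i}` (`0`-indexed, i.e. `p^{d-i}` in `1`-indexed notation). -/
theorem stmt16 (p : ℕ) [Fact p.Prime] (d : ℕ) (hd : 0 < d)
    (Γ : Set (Matrix (Fin d) (Fin d) (ZMod p)))
    (hΓ : Γ = {A | ∃ a : ℕ → ZMod p,
      A = 1 + ∑ k ∈ Finset.Ico 1 d, a (k + 1) • shiftN p d ^ k})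
    (orb : (Fin d → ZMod p) → Set (Fin d → ZMod p))
    (horb : ∀ y, orb y = {z | ∃ A ∈ Γ, z = Matrix.vecMul y A})
    (i : Fin d) (α : (ZMod p)ˣ) :
    orb (fun j => if j = i then (α : ZMod p) else 0) =
      {z | (∀ j, j < i → z j = 0) ∧ z i = (α : ZMod p)} ∧
    ({z : Fin d → ZMod p | (∀ j, j < i → z j = 0) ∧ z i = (α : ZMod p)}).ncard =
      p ^ (d - 1 - (i : ℕ)) := by
  have hentry (a : ℕ → ZMod p) (j : Fin d) :
      Matrix.vecMul (fun j => if j = i then (α : ZMod p) else 0)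
        (1 + ∑ k ∈ Finset.Ico 1 d, a (k + 1) • shiftN p d ^ k) j =
      α * if i = j then 1 else if i < j then a (j - i + 1) else 0 := by
    rw [← one_add_sum_smul_shiftN_pow_apply]
    simp [Matrix.vecMul, dotProduct]
  refine ⟨?_, by rw [ncard_setOf_forall_lt_eq_zero_and_eq, ZMod.card]⟩
  rw [horb, hΓ]
  ext z
  constructor
  · rintro ⟨_, ⟨a, rfl⟩, rfl⟩
    refine ⟨fun j hj => ?_, ?_⟩
    · rw [hentry, if_neg hj.ne', if_neg hj.not_gt, mul_zero]
    · rw [hentry, if_pos rfl, mul_one]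
  · rintro ⟨h0, hα⟩
    let a (m : ℕ) : ZMod p := if h : (i : ℕ) + m - 1 < d then ↑α⁻¹ * z ⟨i + m - 1, h⟩ else 0
    refine ⟨_, ⟨a, rfl⟩, funext fun j => ?_⟩
    rw [hentry]
    rcases lt_trichotomy i j with h | rfl | h
    · have hj : (i : ℕ) + (j - i + 1) - 1 = j := by omega
      rw [if_neg h.ne, if_pos h]
      simp only [a, hj, j.isLt, dite_true, Fin.eta, Units.mul_inv_cancel_left]
    · simp [hα]
    · simp [h.not_gt, h.ne', h0 j h]
end

section
/- Let p be a prime, d ≥ 1, and for t ∈ ℤ/pℤ set e_p(t) = exp(2πi·t/p). Fix 1 ≤ k ≤ d and α ∈ (ℤ/pℤ)ˣ, and let X = {x ∈ (ℤ/pℤ)^d : x_k = α, and x_j = 0 for all j > k}. Then for every y ∈ (ℤ/pℤ)^d, the sum Σ_{x ∈ X} e_p(x·y), where x·y = Σ_j x_j y_j, equals p^{k−1}·e_p(α·y_k) if y_j = 0 for all j < k, and equals 0 otherwise. -/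
/-- `e_p(t) = exp(2πi t / p)` for `t ∈ ℤ/pℤ`. -/
noncomputable def ep (p : ℕ) (t : ZMod p) : ℂ :=
  Complex.exp (2 * Real.pi * Complex.I * (t.val : ℂ) / p)

theorem ep_eq_stdAddChar (p : ℕ) [NeZero p] (t : ZMod p) : ep p t = ZMod.stdAddChar t := by
  rw [ep, ZMod.stdAddChar_apply, ZMod.toCircle_apply]

theorem addChar_map_sum {ι A M : Type*} [AddCommMonoid A] [CommMonoid M] (ψ : AddChar A M)
    (s : Finset ι) (f : ι → A) : ψ (∑ i ∈ s, f i) = ∏ i ∈ s, ψ (f i) :=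
  map_prod ψ.toMonoidHom (fun i => Multiplicative.ofAdd (f i)) s

/-- Let `X = {x ∈ (ℤ/pℤ)^d : x_k = α, x_j = 0 for j > k}` with `α` a unit. Then for
every `y`, `Σ_{x ∈ X} e_p(x·y)` equals `p^{k-1}·e_p(α y_k)` if `y_j = 0` for all
`j < k`, and `0` otherwise (here `k` is `0`-indexed, so the size factor is `p^k`). -/
theorem stmt19 (p : ℕ) [Fact p.Prime] (d : ℕ) (hd : 0 < d)
    (k : Fin d) (α : (ZMod p)ˣ) (y : Fin d → ZMod p) :
    (∑ x ∈ Finset.univ.filter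
        (fun x : Fin d → ZMod p => x k = (α : ZMod p) ∧ ∀ j, k < j → x j = 0),
        ep p (∑ j, x j * y j)) =
      if ∀ j, j < k → y j = 0 then (p : ℂ) ^ (k : ℕ) * ep p ((α : ZMod p) * y k)
      else 0 := by
  classical
  let s : Fin d → Finset (ZMod p) := fun j =>
    if j < k then Finset.univ else if j = k then {(α : ZMod p)} else {0}
  have hX : Finset.univ.filter
      (fun x : Fin d → ZMod p => x k = (α : ZMod p) ∧ ∀ j, k < j → x j = 0) =
      Fintype.piFinset s := by
    ext x
    simp only [Finset.mem_filter, Finset.mem_univ, true_and, Fintype.mem_piFinset, s]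
    constructor
    · rintro ⟨hk, hx⟩ j
      rcases lt_trichotomy j k with h | rfl | h
      · simp [h]
      · simp [hk]
      · simp [h.not_gt, h.ne', hx j h]
    · intro h
      refine ⟨by simpa using h k, fun j hj => ?_⟩
      simpa [hj.not_gt, hj.ne'] using h j
  have hfactor (j : Fin d) : ∑ t ∈ s j, ZMod.stdAddChar (t * y j) =
      (if j < k then (if y j = 0 then (p : ℂ) else 0) else 1) *
        (if j = k then ZMod.stdAddChar ((α : ZMod p) * y k) else 1) := by
    rcases lt_trichotomy j k with h | rfl | h
    · simp [s, h, h.ne, AddChar.sum_mulShift (y j) (ZMod.isPrimitive_stdAddChar p), ZMod.card]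
    · simp [s]
    · simp [s, h.not_gt, h.ne']
  simp only [ep_eq_stdAddChar, addChar_map_sum]
  rw [hX, ← Finset.prod_univ_sum s (fun j t => ZMod.stdAddChar (t * y j))]
  simp only [hfactor, Finset.prod_mul_distrib, Finset.prod_ite_eq', Finset.mem_univ, if_true]
  rw [← Finset.prod_filter]
  split_ifs with hy
  · rw [Finset.prod_congr rfl (g := fun _ => (p : ℂ))
      (fun j hj => if_pos (hy j (Finset.mem_filter.mp hj).2)), Finset.prod_const,
      Finset.filter_gt_eq_Iio, Fin.card_Iio]
  · push Not at hy
    obtain ⟨j, hj, hyj⟩ := hy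
    rw [Finset.prod_eq_zero (Finset.mem_filter.mpr ⟨Finset.mem_univ j, hj⟩) (if_neg hyj), zero_mul]
end
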